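/- arXiv:2512.13027 — 2 statements merged into one kernel-verified Lean document; each statement's English description precedes it below -/
import Mathlib

section
/- Let m ≥ 2 and n ≥ 2 be integers. The set E^{1,in}_{m,n} of injective L-shapes of difference equation type of size (m,n) is finite, and its cardinality equals 1 + |{p/q : p ∈ [m−1], q ∈ [n−1]}|, where |{p/q : p ∈ [m−1], q ∈ [n−1]}| is the number of distinct positive rational numbers representable as p/q with 1 ≤ p ≤ m−1 and 1 ≤ q ≤ n−1. (This common cardinality is the number of generalized Farey intervals of order (m−1, n−1).) -/
open Finset
open scoped Classical
/-- The L-shape domain `L_{m,n} = ([m]×{1}) ∪ ({1}×[n])`. -/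
def LShape (m n : ℕ) : Finset (ℕ × ℕ) :=
  (Finset.Icc 1 m ×ˢ ({1} : Finset ℕ)) ∪ (({1} : Finset ℕ) ×ˢ Finset.Icc 1 n)

/-- The condition `E_{m,n}` on a map defined (at least) on the L-shape. -/
def condE (m n : ℕ) (f : ℕ × ℕ → ℕ) : Prop :=
  (∀ i ∈ Finset.Icc 1 (m - 1),
    (f (i + 1, 1) : ℤ) - (f (i, 1) : ℤ) =
      ((Finset.Icc 1 n).filter (fun t => f (1, t) ≤ f (i + 1, 1))).card) ∧
  (∀ j ∈ Finset.Icc 1 (n - 1),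
    (f (1, j + 1) : ℤ) - (f (1, j) : ℤ) =
      ((Finset.Icc 1 m).filter (fun s => f (s, 1) ≤ f (1, j + 1))).card)

/-- `f` is an injective L-shape of difference equation type of size `(m,n)`:
an injection from `L_{m,n}` into `[mn]` satisfying `E_{m,n}` with `f(1,1) = 1`. -/
def isLShapeDE (m n : ℕ) (f : ℕ × ℕ → ℕ) : Prop :=
  Set.InjOn f (LShape m n) ∧ (∀ p ∈ LShape m n, f p ∈ Finset.Icc 1 (m * n)) ∧
    f (1, 1) = 1 ∧ condE m n f

/-- Number of lattice points of the box `[0,m) × [0,n)` with `x + α y ≤ v`. -/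
def cntS (m n : ℕ) (α v : ℚ) : ℕ :=
  ((range m ×ˢ range n).filter (fun z : ℕ × ℕ => (z.1 : ℚ) + α * z.2 ≤ v)).card

/-- zero-indexed version of the difference equation -/
structure Sol (m n : ℕ) (A B : ℕ → ℕ) : Prop where
  a0 : A 0 = 1
  b0 : B 0 = 1
  ha : ∀ i, i + 1 < m → A (i + 1) = A i + ((range n).filter (fun t => B t ≤ A (i + 1))).card
  hb : ∀ j, j + 1 < n → B (j + 1) = B j + ((range m).filter (fun s => A s ≤ B (j + 1))).card
  hne : ∀ i j, 1 ≤ i → i < m → 1 ≤ j → j < n → A i ≠ B j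

/-- the relative order of `A` and `B` is that of slope `α` -/
structure Pat (m n : ℕ) (α : ℚ) (A B : ℕ → ℕ) : Prop where
  pos : 0 < α
  ne : ∀ i j : ℕ, 1 ≤ i → i < m → 1 ≤ j → j < n → (i : ℚ) ≠ α * j
  iff : ∀ i j : ℕ, 1 ≤ i → i < m → 1 ≤ j → j < n → (A i < B j ↔ (i : ℚ) < α * j)

lemma Sol.symm {m n : ℕ} {A B : ℕ → ℕ} (h : Sol m n A B) : Sol n m B A :=
  ⟨h.b0, h.a0, h.hb, h.ha, fun i j h1 h2 h3 h4 => (h.hne j i h3 h4 h1 h2).symm⟩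

lemma Pat.symm {m n : ℕ} {α : ℚ} {A B : ℕ → ℕ} (h : Sol m n A B) (hp : Pat m n α A B) :
    Pat n m α⁻¹ B A := by
  have h0 := hp.pos
  refine ⟨inv_pos.2 hp.pos, ?_, ?_⟩
  · intro i j h1 h2 h3 h4 he
    apply hp.ne j i h3 h4 h1 h2
    rw [he]; field_simp
  · intro i j h1 h2 h3 h4
    have e1 := hp.iff j i h3 h4 h1 h2
    have e2 := hp.ne j i h3 h4 h1 h2
    have e3 := h.hne j i h3 h4 h1 h2
    have : (B i < A j ↔ ¬ (A j < B i)) := by omega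
    rw [this, e1, lt_inv_mul_iff₀ h0, not_lt]
    exact ⟨fun h => lt_of_le_of_ne h e2.symm, le_of_lt⟩

lemma cntS_zero {m n : ℕ} (hm : 1 ≤ m) (hn : 1 ≤ n) {α : ℚ} (hα : 0 < α) :
    cntS m n α 0 = 1 := by
  unfold cntS
  rw [card_eq_one]
  refine ⟨(0, 0), ?_⟩
  ext ⟨x, y⟩
  simp only [mem_filter, mem_product, mem_range, mem_singleton, Prod.mk.injEq]
  constructor
  · rintro ⟨_, h⟩
    have hx : (0 : ℚ) ≤ x := by positivity
    have hy : (0 : ℚ) ≤ α * y := by positivity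
    have hx' : (x : ℚ) = 0 := by linarith
    have hy' : α * (y : ℚ) = 0 := by linarith
    have hy'' : (y : ℚ) = 0 := by
      rcases mul_eq_zero.1 hy' with h | h
      · exact absurd h hα.ne'
      · exact h
    exact ⟨by exact_mod_cast hx', by exact_mod_cast hy''⟩
  · rintro ⟨rfl, rfl⟩
    refine ⟨⟨by omega, by omega⟩, by simp⟩

lemma cntS_swap {m n : ℕ} {α : ℚ} (hα : 0 < α) (v : ℚ) :
    cntS m n α (α * v) = cntS n m α⁻¹ v := by
  unfold cntS
  refine Finset.card_nbij' (fun z => (z.2, z.1)) (fun z => (z.2, z.1)) ?_ ?_ ?_ ?_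
  · rintro ⟨x, y⟩ h
    simp only [coe_filter, mem_product, mem_range, Set.mem_ofPred_eq] at h ⊢
    refine ⟨h.1.symm, ?_⟩
    have := h.2
    rw [← sub_nonneg] at this ⊢
    have e : v - (y + α⁻¹ * x) = α⁻¹ * (α * v - (x + α * y)) := by field_simp; ring
    rw [e]; positivity
  · rintro ⟨y, x⟩ h
    simp only [coe_filter, mem_product, mem_range, Set.mem_ofPred_eq] at h ⊢
    refine ⟨h.1.symm, ?_⟩
    have := h.2
    rw [← sub_nonneg] at this ⊢
    have e : (α * v - (x + α * y)) = α * (v - (y + α⁻¹ * x)) := by field_simp; ring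
    rw [e]; positivity
  · intro a _; rfl
  · intro a _; rfl

lemma cntS_succ {m n : ℕ} {α : ℚ} (hα : 0 < α) {i : ℕ} (hi : i + 1 < m) :
    cntS m n α ((i + 1 : ℕ) : ℚ) =
      cntS m n α (i : ℚ) + ((range n).filter (fun t : ℕ => α * t ≤ ((i + 1 : ℕ) : ℚ))).card := by
  unfold cntS
  have e : ((range m ×ˢ range n).filter
      (fun z : ℕ × ℕ => (z.1 : ℚ) + α * z.2 ≤ ((i + 1 : ℕ) : ℚ))) =
      (((range m ×ˢ range n).filter (fun z : ℕ × ℕ => (z.1 : ℚ) + α * z.2 ≤ (i : ℚ))).image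
        (fun z => (z.1 + 1, z.2))) ∪
      (((range n).filter (fun t : ℕ => α * t ≤ ((i + 1 : ℕ) : ℚ))).image (fun t => (0, t))) := by
    ext ⟨x, y⟩
    simp only [mem_filter, mem_product, mem_range, mem_union, mem_image, Prod.mk.injEq,
      Prod.exists]
    constructor
    · rintro ⟨⟨h1, h2⟩, h3⟩
      rcases x with _ | x
      · right
        exact ⟨y, ⟨h2, by simpa using h3⟩, rfl, rfl⟩
      · left
        refine ⟨x, y, ⟨⟨by omega, h2⟩, ?_⟩, rfl, rfl⟩
        push_cast at h3; linarith
    · rintro (⟨x', y', ⟨⟨h1, h2⟩, h3⟩, rfl, rfl⟩ | ⟨t, ⟨h1, h2⟩, rfl, rfl⟩)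
      · refine ⟨⟨?_, h2⟩, by push_cast; linarith⟩
        have hy : (0 : ℚ) ≤ α * y' := by positivity
        have : (x' : ℚ) ≤ i := by linarith
        have : x' ≤ i := by exact_mod_cast this
        omega
      · exact ⟨⟨by omega, h1⟩, by simpa using h2⟩
  rw [e, card_union_of_disjoint, card_image_of_injective, card_image_of_injective]
  · intro a b h; simpa using h
  · rintro ⟨a, b⟩ ⟨c, d⟩ h; simpa using h
  · rw [Finset.disjoint_left]
    rintro ⟨x, y⟩ h1 h2
    simp only [mem_image, Prod.mk.injEq] at h1 h2
    obtain ⟨_, _, h1, _⟩ := h1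
    obtain ⟨_, _, h2, _⟩ := h2
    omega

lemma Sol.a_pos {m n : ℕ} {A B : ℕ → ℕ} (h : Sol m n A B) : ∀ i, i < m → 1 ≤ A i := by
  intro i
  induction i with
  | zero => intro _; rw [h.a0]
  | succ i ih => intro hi; have := h.ha i hi; have := ih (by omega); omega

lemma Sol.a_lt {m n : ℕ} {A B : ℕ → ℕ} (h : Sol m n A B) (hn : 1 ≤ n) :
    ∀ i j, i < j → j < m → A i < A j := by
  intro i j hij
  induction j, hij using Nat.le_induction with
  | base =>
    intro hi
    have h1 := h.ha i hi
    have : 0 < ((range n).filter (fun t => B t ≤ A (i + 1))).card := by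
      rw [card_pos]
      exact ⟨0, by simp [h.b0]; exact ⟨by omega, h.a_pos _ hi⟩⟩
    show A i < A (i + 1)
    omega
  | succ j hj ih =>
    intro hi
    have h1 := h.ha j hi
    have := ih (by omega)
    omega

lemma Sol.eq_a {m n : ℕ} {A B : ℕ → ℕ} {α : ℚ} (h : Sol m n A B) (hp : Pat m n α A B)
    (hn : 1 ≤ n) : ∀ i, i < m → A i = cntS m n α i := by
  intro i
  induction i with
  | zero => intro hi; rw [h.a0, Nat.cast_zero, cntS_zero (by omega) hn hp.pos]
  | succ i ih =>
    intro hi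
    rw [h.ha i hi, cntS_succ hp.pos hi, ih (by omega)]
    congr 2
    apply filter_congr
    intro t ht
    rw [mem_range] at ht
    rcases Nat.eq_zero_or_pos t with rfl | h0
    · have := h.a_pos _ hi
      simp only [h.b0, this, Nat.cast_zero, mul_zero, true_iff]
      positivity
    · have := hp.iff (i + 1) t (by omega) hi h0 ht
      rw [← not_lt, this, not_lt]

lemma Sol.eq_b {m n : ℕ} {A B : ℕ → ℕ} {α : ℚ} (h : Sol m n A B) (hp : Pat m n α A B)
    (hm : 1 ≤ m) : ∀ j, j < n → B j = cntS m n α (α * j) := by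
  intro j hj
  rw [cntS_swap hp.pos]
  exact h.symm.eq_a (hp.symm h) hm j hj

/-- restriction -/
lemma Sol.restrict {m n : ℕ} {A B : ℕ → ℕ} (h : Sol (m + 1) n A B)
    (hlt : ∀ j, j < n → B j < A m) : Sol m n A B := by
  refine ⟨h.a0, h.b0, fun i hi => h.ha i (by omega), ?_,
    fun i j h1 h2 h3 h4 => h.hne i j h1 (by omega) h3 h4⟩
  intro j hj
  have h1 := h.hb j hj
  have h2 := hlt _ hj
  rw [range_add_one, filter_insert, if_neg (by omega)] at h1
  exact h1

/-- Key inductive step. -/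
lemma step {m n : ℕ} (hm : 1 ≤ m) (hn : 2 ≤ n) {A B : ℕ → ℕ} (h : Sol (m + 1) n A B)
    (hlast : B (n - 1) < A m) {α : ℚ} (hp : Pat m n α A B) :
    ∃ β, Pat (m + 1) n β A B := by
  have hlt : ∀ j, j < n → B j < A m := by
    intro j hj
    rcases Nat.lt_or_ge j (n - 1) with h1 | h1
    · have := h.symm.a_lt (by omega) j (n - 1) h1 (by omega)
      omega
    · have : j = n - 1 := by omega
      rw [this]; exact hlast
  have hr := h.restrict hlt
  have hα := hp.pos
  -- the maximal fraction below `α`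
  obtain ⟨⟨p, q⟩, hpq, hmax⟩ := Finset.exists_max_image
    ((range m ×ˢ Finset.Ico 1 n).filter (fun z : ℕ × ℕ => (z.1 : ℚ) < α * z.2))
    (fun z => (z.1 : ℚ) / z.2) ⟨(0, 1), by simp; exact ⟨⟨by omega, by omega⟩, hα⟩⟩
  simp only [mem_filter, mem_product, mem_range, mem_Ico, Prod.forall] at hpq hmax
  obtain ⟨⟨hpm, hq1, hqn⟩, hpα⟩ := hpq
  have hq0 : (0 : ℚ) < q := by exact_mod_cast hq1
  obtain ⟨l, hl⟩ : ∃ l : ℚ, l = (p : ℚ) / q := ⟨_, rfl⟩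
  have hlq : l * q = p := by rw [hl]; field_simp
  have hlα : l < α := by rw [hl, div_lt_iff₀ hq0]; exact hpα
  have hl0 : 0 ≤ l := by rw [hl]; positivity
  have hn1 : (0 : ℚ) < ((n - 1 : ℕ) : ℚ) := by
    have : 0 < n - 1 := by omega
    exact_mod_cast this
  rcases lt_or_ge (l * ((n - 1 : ℕ) : ℚ)) m with hc | hc
  · have hl2 : l < (m : ℚ) / ((n - 1 : ℕ) : ℚ) := by rwa [lt_div_iff₀ hn1]
    obtain ⟨β, hβ1, hβ2⟩ := exists_between (lt_min hlα hl2)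
    rw [lt_min_iff] at hβ2
    obtain ⟨hβα, hβm⟩ := hβ2
    rw [lt_div_iff₀ hn1] at hβm
    have hβ0 : 0 < β := by linarith
    have hbig : ∀ j : ℕ, j < n → β * j < m := by
      intro j hj
      have : (j : ℚ) ≤ ((n - 1 : ℕ) : ℚ) := by
        have : j ≤ n - 1 := by omega
        exact_mod_cast this
      have := mul_le_mul_of_nonneg_left this hβ0.le
      linarith
    have key : ∀ i j : ℕ, 1 ≤ i → i < m → 1 ≤ j → j < n →
        ((i : ℚ) < α * j → (i : ℚ) < β * j) ∧ (α * j < (i : ℚ) → β * j < i) := by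
      intro i j h1 h2 h3 h4
      have hj : (0 : ℚ) < j := by exact_mod_cast h3
      constructor
      · intro hi
        have := hmax i j ⟨⟨h2, h3, h4⟩, hi⟩
        rw [← hl] at this
        rw [← div_lt_iff₀ hj]; linarith
      · intro hi
        have := mul_lt_mul_of_pos_right hβα hj
        linarith
    refine ⟨β, hβ0, ?_, ?_⟩
    · intro i j h1 h2 h3 h4
      rcases Nat.lt_or_ge i m with h5 | h5
      · have k := key i j h1 h5 h3 h4
        rcases lt_or_gt_of_ne (hp.ne i j h1 h5 h3 h4) with h6 | h6
        · exact (k.1 h6).ne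
        · exact (k.2 h6).ne'
      · have : i = m := by omega
        subst this
        exact (hbig j h4).ne'
    · intro i j h1 h2 h3 h4
      rcases Nat.lt_or_ge i m with h5 | h5
      · have k := key i j h1 h5 h3 h4
        rw [hp.iff i j h1 h5 h3 h4]
        refine ⟨k.1, fun h7 => ?_⟩
        rcases lt_or_gt_of_ne (hp.ne i j h1 h5 h3 h4) with h6 | h6
        · exact h6
        · exact absurd (k.2 h6) (not_lt.2 h7.le)
      · have : i = m := by omega
        subst this
        have a1 := hlt j h4
        have a2 := hbig j h4
        constructor
        · intro h; omega
        · intro h; linarith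
  · exfalso
    -- contradiction by counting
    obtain ⟨k, rfl⟩ : ∃ k, m = k + 1 := ⟨m - 1, by omega⟩
    have e1 : A (k + 1) = A k + n := by
      rw [h.ha k (by omega)]
      congr 1
      rw [filter_true_of_mem, card_range]
      intro t ht
      exact (hlt t (mem_range.1 ht)).le
    have e2 := hr.eq_a hp (by omega) k (by omega)
    have e3 := hr.eq_b hp (by omega) (n - 1) (by omega)
    have hpk : (p : ℚ) ≤ k := by exact_mod_cast (by omega : p ≤ k)
    have hqn' : q < n - 1 := by
      by_contra hcon
      have : ((n - 1 : ℕ) : ℚ) ≤ q := by exact_mod_cast not_lt.1 hcon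
      have := mul_le_mul_of_nonneg_left this hl0
      push_cast at hc
      linarith
    have hp1 : 1 ≤ p := by
      by_contra hcon
      have : p = 0 := by omega
      subst this
      have : l = 0 := by rw [hl]; simp
      rw [this] at hc
      push_cast at hc
      have : (0 : ℚ) ≤ k := by positivity
      linarith
    have hlαn : l * ((n - 1 : ℕ) : ℚ) < α * ((n - 1 : ℕ) : ℚ) := mul_lt_mul_of_pos_right hlα hn1
    have hcast : ((n - 1 - q : ℕ) : ℚ) = ((n - 1 : ℕ) : ℚ) - q := by
      rw [Nat.cast_sub hqn'.le]
    have hval : ((k + 1 : ℕ) : ℚ) < p + α * ((n - 1 - q : ℕ) : ℚ) := by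
      have h1 : (0 : ℚ) < ((n - 1 - q : ℕ) : ℚ) := by
        exact_mod_cast (by omega : 0 < n - 1 - q)
      have h2 := mul_lt_mul_of_pos_right hlα h1
      rw [hcast] at h2 ⊢
      linarith
    -- the three sets
    set S0 := ((range (k + 1) ×ˢ range n).filter
      (fun z : ℕ × ℕ => (z.1 : ℚ) + α * z.2 ≤ (k : ℚ))) with hS0
    set S1 := ((range (k + 1) ×ˢ range n).filter
      (fun z : ℕ × ℕ => (z.1 : ℚ) + α * z.2 ≤ α * ((n - 1 : ℕ) : ℚ))) with hS1
    have e2' : A k = S0.card := e2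
    have e3' : B (n - 1) = S1.card := e3
    have hsub : (insert (p, n - 1 - q) (((S0.erase (k, 0)).image (fun z => (z.1 + 1, z.2))) ∪
        ((range n).image (fun t => (0, t))))) ⊆ S1 := by
      intro z hz
      simp only [mem_insert, mem_union, mem_image, mem_erase] at hz
      rw [hS1, mem_filter, mem_product, mem_range, mem_range]
      rcases hz with rfl | ⟨⟨x, y⟩, ⟨hz1, hz2⟩, rfl⟩ | ⟨t, ht, rfl⟩
      · refine ⟨⟨hpm, by dsimp only; omega⟩, ?_⟩
        dsimp only
        rw [hcast]; linarith
      · simp only [hS0, mem_filter, mem_product, mem_range] at hz2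
        obtain ⟨⟨hx, hy⟩, hv⟩ := hz2
        refine ⟨⟨?_, hy⟩, ?_⟩
        · by_contra hcon
          have hxk : x = k := by dsimp only at hcon; omega
          subst hxk
          have : α * (y : ℚ) ≤ 0 := by linarith
          have hy0 : y = 0 := by
            by_contra hy0
            have : (0 : ℚ) < y := by exact_mod_cast Nat.pos_of_ne_zero hy0
            have := mul_pos hα this
            linarith
          exact hz1 (by rw [hy0])
        · push_cast at hc ⊢
          linarith
      · rw [mem_range] at ht
        refine ⟨⟨by dsimp only; omega, ht⟩, ?_⟩
        have : (t : ℚ) ≤ ((n - 1 : ℕ) : ℚ) := by exact_mod_cast (by omega : t ≤ n - 1)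
        have := mul_le_mul_of_nonneg_left this hα.le
        simpa using this
    have hcard := card_le_card hsub
    rw [card_insert_of_notMem, card_union_of_disjoint, card_image_of_injective,
      card_image_of_injective, card_range, card_erase_of_mem] at hcard
    · have : 1 ≤ S0.card := by rw [← e2']; exact h.a_pos _ (by omega)
      omega
    · simp [hS0]; omega
    · intro a b h; simpa using h
    · rintro ⟨a, b⟩ ⟨c, d⟩ h; simpa using h
    · rw [Finset.disjoint_left]
      rintro ⟨x, y⟩ h1 h2
      simp only [mem_image, Prod.mk.injEq] at h1 h2
      obtain ⟨_, _, h1, _⟩ := h1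
      obtain ⟨_, _, h2, _⟩ := h2
      omega
    · intro hz
      simp only [mem_union, mem_image, mem_erase, Prod.mk.injEq, Prod.exists] at hz
      rcases hz with ⟨x, y, ⟨_, hz2⟩, rfl, hy⟩ | ⟨t, ht, h1, _⟩
      · simp only [hS0, mem_filter, mem_product, mem_range] at hz2
        rw [← hy] at hval
        push_cast at hval
        linarith [hz2.2]
      · omega

lemma exists_pat : ∀ (N m n : ℕ) (A B : ℕ → ℕ), m + n ≤ N → 1 ≤ m → 1 ≤ n → Sol m n A B →
    ∃ α, Pat m n α A B := by
  intro N
  induction N with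
  | zero => intro m n A B h1 h2; omega
  | succ N ih =>
    intro m n A B hN hm hn h
    rcases Nat.lt_or_ge m 2 with h2 | h2
    · exact ⟨1, one_pos, fun i j _ _ => by omega, fun i j _ _ => by omega⟩
    rcases Nat.lt_or_ge n 2 with h3 | h3
    · exact ⟨1, one_pos, fun i j _ _ _ _ => by omega, fun i j _ _ _ _ => by omega⟩
    obtain ⟨m, rfl⟩ : ∃ k, m = k + 1 := ⟨m - 1, by omega⟩
    obtain ⟨n, rfl⟩ : ∃ k, n = k + 1 := ⟨n - 1, by omega⟩
    have main : ∀ (m n : ℕ) (A B : ℕ → ℕ), m + 1 + (n + 1) ≤ N + 1 → 1 ≤ m → 1 ≤ n →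
        Sol (m + 1) (n + 1) A B → B n < A m → ∃ α, Pat (m + 1) (n + 1) α A B := by
      intro m n A B hN hm hn h hlt
      have hr : Sol m (n + 1) A B := h.restrict (by
        intro j hj
        rcases Nat.lt_or_ge j n with h1 | h1
        · have := h.symm.a_lt (by omega) j n h1 (by omega)
          omega
        · have : j = n := by omega
          rw [this]; exact hlt)
      obtain ⟨α, hα⟩ := ih m (n + 1) A B (by omega) hm (by omega) hr
      exact step hm (by omega) h hlt hα
    rcases lt_or_gt_of_ne (h.hne m n (by omega) (by omega) (by omega) (by omega)) with h4 | h4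
    · obtain ⟨α, hα⟩ := main n m B A (by omega) (by omega) (by omega) h.symm h4
      exact ⟨_, hα.symm h.symm⟩
    · exact main m n A B (by omega) (by omega) (by omega) h h4

lemma cntS_le_of_le {m n : ℕ} {α v w : ℚ} (h : v ≤ w) : cntS m n α v ≤ cntS m n α w := by
  apply card_le_card
  intro z
  simp only [mem_filter]
  exact fun hz => ⟨hz.1, hz.2.trans h⟩

lemma cntS_lt_a {m n : ℕ} {α v : ℚ} {i : ℕ} (hi : i < m) (hn : 1 ≤ n) (h : v < i) :
    cntS m n α v < cntS m n α i := by
  apply card_lt_card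
  rw [ssubset_iff_of_subset]
  · refine ⟨(i, 0), ?_, ?_⟩
    · simp [hi]; omega
    · simp [h]
  · intro z
    simp only [mem_filter]
    exact fun hz => ⟨hz.1, hz.2.trans h.le⟩

lemma cntS_lt_b {m n : ℕ} {α v : ℚ} {j : ℕ} (hj : j < n) (hm : 1 ≤ m) (h : v < α * j) :
    cntS m n α v < cntS m n α (α * j) := by
  apply card_lt_card
  rw [ssubset_iff_of_subset]
  · refine ⟨(0, j), ?_, ?_⟩
    · simp [hj]; omega
    · simp [h]
  · intro z
    simp only [mem_filter]
    exact fun hz => ⟨hz.1, hz.2.trans h.le⟩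

lemma sol_pat_cntS {m n : ℕ} (hm : 1 ≤ m) (hn : 1 ≤ n) {α : ℚ} (hα : 0 < α)
    (hne : ∀ i j : ℕ, 1 ≤ i → i < m → 1 ≤ j → j < n → (i : ℚ) ≠ α * j) :
    Sol m n (fun i => cntS m n α i) (fun j => cntS m n α (α * j)) ∧
    Pat m n α (fun i => cntS m n α i) (fun j => cntS m n α (α * j)) := by
  have le_ba : ∀ i j : ℕ, i < m → j < n →
      (cntS m n α (α * j) ≤ cntS m n α i ↔ α * j ≤ i) := by
    intro i j hi hj
    refine ⟨fun h => ?_, cntS_le_of_le⟩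
    by_contra hc
    exact absurd (cntS_lt_b hj hm (not_le.1 hc)) (not_lt.2 h)
  have le_ab : ∀ i j : ℕ, i < m → j < n →
      (cntS m n α i ≤ cntS m n α (α * j) ↔ (i : ℚ) ≤ α * j) := by
    intro i j hi hj
    refine ⟨fun h => ?_, cntS_le_of_le⟩
    by_contra hc
    exact absurd (cntS_lt_a hi hn (not_le.1 hc)) (not_lt.2 h)
  refine ⟨⟨?_, ?_, ?_, ?_, ?_⟩, ⟨hα, hne, ?_⟩⟩
  · simpa using cntS_zero hm hn hα
  · simpa using cntS_zero hm hn hα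
  · intro i hi
    rw [cntS_succ hα hi]
    congr 2
    apply filter_congr
    intro t ht
    rw [← cntS_succ hα hi, le_ba _ _ hi (mem_range.1 ht)]
  · intro j hj
    have e : cntS m n α (α * ((j + 1 : ℕ) : ℚ)) = cntS m n α (α * j) +
        ((range m).filter (fun t : ℕ => α⁻¹ * t ≤ ((j + 1 : ℕ) : ℚ))).card := by
      rw [cntS_swap hα, cntS_swap hα, cntS_succ (inv_pos.2 hα) hj]
    rw [e]
    congr 2
    apply filter_congr
    intro s hs
    rw [← e, le_ab _ _ (mem_range.1 hs) hj, inv_mul_le_iff₀ hα]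
  · intro i j h1 h2 h3 h4 he
    exact hne i j h1 h2 h3 h4
      (le_antisymm ((le_ab i j h2 h4).1 he.le) ((le_ba i j h2 h4).1 he.ge))
  · intro i j h1 h2 h3 h4
    rw [← not_le, le_ba i j h2 h4, not_le]

/-- the L-shape attached to a slope -/
def shapeOf (m n : ℕ) (α : ℚ) (z : ℕ × ℕ) : ℕ :=
  if z ∈ LShape m n then
    (if z.2 = 1 then cntS m n α ((z.1 - 1 : ℕ) : ℚ) else cntS m n α (α * ((z.2 - 1 : ℕ) : ℚ)))
  else 0

lemma mem_LShape {m n : ℕ} (x y : ℕ) :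
    (x, y) ∈ LShape m n ↔ (1 ≤ x ∧ x ≤ m ∧ y = 1) ∨ (x = 1 ∧ 1 ≤ y ∧ y ≤ n) := by
  simp only [LShape, mem_union, mem_product, mem_Icc, mem_singleton]
  omega

lemma shapeOf_a {m n : ℕ} {α : ℚ} {i : ℕ} (hi : i < m) :
    shapeOf m n α (i + 1, 1) = cntS m n α i := by
  have : (i + 1, 1) ∈ LShape m n := by rw [mem_LShape]; omega
  simp [shapeOf, this]

lemma shapeOf_b {m n : ℕ} {α : ℚ} {j : ℕ} (hj : j < n) :
    shapeOf m n α (1, j + 1) = cntS m n α (α * j) := by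
  have : (1, j + 1) ∈ LShape m n := by rw [mem_LShape]; omega
  rcases j with _ | j
  · simp [shapeOf, this]
  · simp [shapeOf, this]

lemma card_shift (n : ℕ) (P : ℕ → Prop) [DecidablePred P] :
    ((Finset.Icc 1 n).filter P).card = ((range n).filter (fun t => P (t + 1))).card := by
  refine Finset.card_nbij' (fun z => z - 1) (fun z => z + 1) ?_ ?_ ?_ ?_
  · intro x h
    simp only [coe_filter, mem_Icc, mem_range, Set.mem_ofPred_eq] at h ⊢
    refine ⟨by omega, ?_⟩
    rw [Nat.sub_add_cancel h.1.1]; exact h.2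
  · intro x h
    simp only [coe_filter, mem_Icc, mem_range, Set.mem_ofPred_eq] at h ⊢
    exact ⟨by omega, h.2⟩
  · intro x h
    simp only [coe_filter, mem_Icc, Set.mem_ofPred_eq] at h
    dsimp only; omega
  · intro x h
    dsimp only; omega

lemma sol_of_shape {m n : ℕ} (hm : 1 ≤ m) (hn : 1 ≤ n) {f : ℕ × ℕ → ℕ}
    (h : isLShapeDE m n f) :
    Sol m n (fun i => f (i + 1, 1)) (fun j => f (1, j + 1)) := by
  obtain ⟨hinj, hb, h1, ha, hb'⟩ := h
  refine ⟨h1, h1, ?_, ?_, ?_⟩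
  · intro i hi
    have := ha (i + 1) (by rw [mem_Icc]; omega)
    rw [card_shift] at this
    omega
  · intro i hi
    have := hb' (i + 1) (by rw [mem_Icc]; omega)
    rw [card_shift] at this
    omega
  · intro i j h1 h2 h3 h4 he
    have := hinj (x₁ := (i + 1, 1)) (x₂ := (1, j + 1))
      (by rw [mem_coe, mem_LShape]; omega) (by rw [mem_coe, mem_LShape]; omega) he
    rw [Prod.mk.injEq] at this
    omega

lemma shape_of_sol {m n : ℕ} (hm : 1 ≤ m) (hn : 1 ≤ n) {f : ℕ × ℕ → ℕ}
    (h : Sol m n (fun i => f (i + 1, 1)) (fun j => f (1, j + 1)))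
    (hle : ∀ p ∈ LShape m n, f p ≤ m * n) : isLShapeDE m n f := by
  have hA : ∀ i j, i < j → j < m → f (i + 1, 1) < f (j + 1, 1) := h.a_lt hn
  have hB : ∀ i j, i < j → j < n → f (1, i + 1) < f (1, j + 1) := h.symm.a_lt hm
  have hAp : ∀ i, i < m → 1 ≤ f (i + 1, 1) := h.a_pos
  have hBp : ∀ i, i < n → 1 ≤ f (1, i + 1) := h.symm.a_pos
  have hN : ∀ i j, 1 ≤ i → i < m → 1 ≤ j → j < n → f (i + 1, 1) ≠ f (1, j + 1) := h.hne
  have h11 : f (1, 1) = 1 := h.a0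
  have cases : ∀ z ∈ LShape m n, (∃ i, i < m ∧ z = (i + 1, 1)) ∨
      (∃ j, 1 ≤ j ∧ j < n ∧ z = (1, j + 1)) := by
    rintro ⟨x, y⟩ hz
    rw [mem_LShape] at hz
    by_cases hy : y = 1
    · left
      refine ⟨x - 1, by omega, ?_⟩
      rw [Prod.mk.injEq]; omega
    · right
      refine ⟨y - 1, by omega, by omega, ?_⟩
      rw [Prod.mk.injEq]; omega
  have hN' : ∀ i j, i < m → 1 ≤ j → j < n → f (i + 1, 1) ≠ f (1, j + 1) := by
    intro i j h1 h2 h3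
    rcases Nat.eq_zero_or_pos i with rfl | h0
    · have := hB 0 j (by omega) h3
      simp only [zero_add] at this ⊢
      omega
    · exact hN i j h0 h1 h2 h3
  refine ⟨?_, ?_, h11, ?_, ?_⟩
  · intro z hz w hw he
    rcases cases z hz with ⟨i, hi, rfl⟩ | ⟨i, hi, hi', rfl⟩ <;>
    rcases cases w hw with ⟨j, hj, rfl⟩ | ⟨j, hj, hj', rfl⟩
    · rcases Nat.lt_trichotomy i j with h1 | h1 | h1
      · have := hA i j h1 hj; omega
      · rw [h1]
      · have := hA j i h1 hi; omega
    · exact absurd he (hN' i j hi hj hj')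
    · exact absurd he.symm (hN' j i hj hi hi')
    · rcases Nat.lt_trichotomy i j with h1 | h1 | h1
      · have := hB i j h1 hj'; omega
      · rw [h1]
      · have := hB j i h1 hi'; omega
  · intro z hz
    rw [mem_Icc]
    refine ⟨?_, hle z hz⟩
    rcases cases z hz with ⟨i, hi, rfl⟩ | ⟨i, hi, hi', rfl⟩
    · exact hAp i hi
    · exact hBp i hi'
  · intro i hi
    rw [mem_Icc] at hi
    obtain ⟨i, rfl⟩ : ∃ k, i = k + 1 := ⟨i - 1, by omega⟩
    have := h.ha i (by omega)
    rw [card_shift]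
    omega
  · intro i hi
    rw [mem_Icc] at hi
    obtain ⟨i, rfl⟩ : ∃ k, i = k + 1 := ⟨i - 1, by omega⟩
    have := h.hb i (by omega)
    rw [card_shift]
    omega

lemma cntS_le {m n : ℕ} {α v : ℚ} : cntS m n α v ≤ m * n := by
  unfold cntS
  refine (card_filter_le _ _).trans ?_
  simp

lemma Sol.congr {m n : ℕ} {A B A' B' : ℕ → ℕ} (h : Sol m n A B) (hm : 1 ≤ m) (hn : 1 ≤ n)
    (hA : ∀ i, i < m → A' i = A i) (hB : ∀ j, j < n → B' j = B j) : Sol m n A' B' := by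
  refine ⟨by rw [hA 0 hm, h.a0], by rw [hB 0 hn, h.b0], ?_, ?_, ?_⟩
  · intro i hi
    rw [hA _ hi, hA i (by omega), h.ha i hi]
    congr 2
    apply filter_congr
    intro t ht
    rw [hB t (mem_range.1 ht), ← h.ha i hi]
  · intro i hi
    rw [hB _ hi, hB i (by omega), h.hb i hi]
    congr 2
    apply filter_congr
    intro t ht
    rw [hA t (mem_range.1 ht), ← h.hb i hi]
  · intro i j h1 h2 h3 h4
    rw [hA i h2, hB j h4]
    exact h.hne i j h1 h2 h3 h4

lemma exists_above (F : Finset ℚ) (l : ℚ) : ∃ α, l < α ∧ ∀ x ∈ F, l < x → α < x := by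
  induction F using Finset.induction_on with
  | empty => exact ⟨l + 1, by linarith, by simp⟩
  | insert a s ha ih =>
    obtain ⟨α, h1, h2⟩ := ih
    by_cases hla : l < a
    · obtain ⟨β, h3, h4⟩ := exists_between (lt_min h1 hla)
      rw [lt_min_iff] at h4
      refine ⟨β, h3, ?_⟩
      intro x hx hlx
      rcases mem_insert.1 hx with rfl | hx
      · exact h4.2
      · exact h4.1.trans (h2 x hx hlx)
    · refine ⟨α, h1, ?_⟩
      intro x hx hlx
      rcases mem_insert.1 hx with rfl | hx
      · exact absurd hlx hla
      · exact h2 x hx hlx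

/-- two slopes with the same pattern give the same shape -/
lemma shape_eq_of_pat {m n : ℕ} (hm : 1 ≤ m) (hn : 1 ≤ n) {f : ℕ × ℕ → ℕ} {α : ℚ}
    (h : Sol m n (fun i => f (i + 1, 1)) (fun j => f (1, j + 1)))
    (hp : Pat m n α (fun i => f (i + 1, 1)) (fun j => f (1, j + 1)))
    (h0 : ∀ p ∉ LShape m n, f p = 0) : shapeOf m n α = f := by
  funext ⟨x, y⟩
  by_cases hz : (x, y) ∈ LShape m n
  · have hz' := hz
    rw [mem_LShape] at hz'
    rcases hz' with ⟨h1, h2, rfl⟩ | ⟨rfl, h1, h2⟩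
    · obtain ⟨i, rfl⟩ : ∃ k, x = k + 1 := ⟨x - 1, by omega⟩
      rw [shapeOf_a (by omega)]
      exact (h.eq_a hp hn i (by omega)).symm
    · obtain ⟨i, rfl⟩ : ∃ k, y = k + 1 := ⟨y - 1, by omega⟩
      rw [shapeOf_b (by omega)]
      exact (h.eq_b hp hm i (by omega)).symm
  · rw [h0 _ hz]
    simp [shapeOf, hz]

/-- the number of injective L-shapes of difference equation type of size `(m,n)`
(`m,n ≥ 2`) is `1` plus the number of distinct rationals `p/q` with `p ∈ [m−1]`, `q ∈ [n−1]`. -/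
theorem card_lshapeDE (m n : ℕ) (hm : 2 ≤ m) (hn : 2 ≤ n) :
    {f : ℕ × ℕ → ℕ | isLShapeDE m n f ∧ ∀ p ∉ LShape m n, f p = 0}.Finite ∧
    {f : ℕ × ℕ → ℕ | isLShapeDE m n f ∧ ∀ p ∉ LShape m n, f p = 0}.ncard =
      1 + ((Finset.Icc 1 (m - 1) ×ˢ Finset.Icc 1 (n - 1)).image
        (fun pq : ℕ × ℕ => (pq.1 : ℚ) / (pq.2 : ℚ))).card := by
  have hm1 : 1 ≤ m := by omega
  have hn1 : 1 ≤ n := by omega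
  set F := ((Finset.Icc 1 (m - 1) ×ˢ Finset.Icc 1 (n - 1)).image
        (fun pq : ℕ × ℕ => (pq.1 : ℚ) / (pq.2 : ℚ))) with hF
  have memF : ∀ i j : ℕ, 1 ≤ i → i < m → 1 ≤ j → j < n → (i : ℚ) / j ∈ F := by
    intro i j h1 h2 h3 h4
    rw [hF, mem_image]
    refine ⟨(i, j), ?_, rfl⟩
    simp only [mem_product, mem_Icc]
    omega
  have Fmem : ∀ x ∈ F, ∃ i j : ℕ, 1 ≤ i ∧ i < m ∧ 1 ≤ j ∧ j < n ∧ x = (i : ℚ) / j := by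
    intro x hx
    rw [hF, mem_image] at hx
    obtain ⟨⟨i, j⟩, h1, rfl⟩ := hx
    simp only [mem_product, mem_Icc] at h1
    exact ⟨i, j, by omega, by omega, by omega, by omega, rfl⟩
  have Fpos : ∀ x ∈ F, 0 < x := by
    intro x hx
    obtain ⟨i, j, h1, h2, h3, h4, rfl⟩ := Fmem x hx
    have : (0 : ℚ) < i := by exact_mod_cast h1
    have : (0 : ℚ) < j := by exact_mod_cast h3
    positivity
  choose up hup1 hup2 using exists_above F
  have G0 : ∀ l ∈ insert 0 F, 0 ≤ l := by
    intro l hl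
    rcases mem_insert.1 hl with rfl | hl
    · exact le_rfl
    · exact (Fpos l hl).le
  have upne : ∀ l, ∀ i j : ℕ, 1 ≤ i → i < m → 1 ≤ j → j < n → (i : ℚ) ≠ up l * j := by
    intro l i j h1 h2 h3 h4 he
    have hj : (0 : ℚ) < j := by exact_mod_cast h3
    have h5 := memF i j h1 h2 h3 h4
    have h6 : (i : ℚ) / j = up l := by rw [he]; field_simp
    have := hup2 l _ h5 (by rw [h6]; exact hup1 l)
    linarith
  have upiff : ∀ l, ∀ i j : ℕ, 1 ≤ i → i < m → 1 ≤ j → j < n →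
      ((i : ℚ) < up l * j ↔ (i : ℚ) / j ≤ l) := by
    intro l i j h1 h2 h3 h4
    have hj : (0 : ℚ) < j := by exact_mod_cast h3
    rw [← div_lt_iff₀ hj]
    constructor
    · intro h
      by_contra hc
      have := hup2 l _ (memF i j h1 h2 h3 h4) (not_le.1 hc)
      linarith
    · intro h
      exact lt_of_le_of_lt h (hup1 l)
  have solup : ∀ l ∈ insert 0 F,
      Sol m n (fun i => cntS m n (up l) i) (fun j => cntS m n (up l) (up l * j)) ∧
      Pat m n (up l) (fun i => cntS m n (up l) i) (fun j => cntS m n (up l) (up l * j)) := by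
    intro l hl
    exact sol_pat_cntS hm1 hn1 (lt_of_le_of_lt (G0 l hl) (hup1 l)) (upne l)
  have hset : {f : ℕ × ℕ → ℕ | isLShapeDE m n f ∧ ∀ p ∉ LShape m n, f p = 0} =
      (fun l => shapeOf m n (up l)) '' ((insert 0 F : Finset ℚ) : Set ℚ) := by
    ext f
    simp only [Set.mem_ofPred_eq, Set.mem_image, mem_coe]
    constructor
    · rintro ⟨hf, hf0⟩
      have hs := sol_of_shape hm1 hn1 hf
      obtain ⟨α, hα⟩ := exists_pat _ m n _ _ le_rfl hm1 hn1 hs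
      obtain ⟨l, hl, hmax⟩ := Finset.exists_max_image ((insert 0 F).filter (fun x => x < α)) id
        ⟨0, by simp [hα.pos]⟩
      rw [mem_filter] at hl
      refine ⟨l, hl.1, ?_⟩
      refine shape_eq_of_pat hm1 hn1 hs
        ⟨lt_of_le_of_lt (G0 l hl.1) (hup1 l), upne l, ?_⟩ hf0
      intro i j h1 h2 h3 h4
      have hj : (0 : ℚ) < j := by exact_mod_cast h3
      rw [hα.iff i j h1 h2 h3 h4, upiff l i j h1 h2 h3 h4, ← div_lt_iff₀ hj]
      constructor
      · intro h
        exact hmax _ (mem_filter.2 ⟨mem_insert_of_mem (memF i j h1 h2 h3 h4), h⟩)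
      · intro h
        exact lt_of_le_of_lt h hl.2
    · rintro ⟨l, hl, rfl⟩
      refine ⟨shape_of_sol hm1 hn1 ?_ ?_, ?_⟩
      · exact (solup l hl).1.congr hm1 hn1 (fun i hi => shapeOf_a hi) (fun j hj => shapeOf_b hj)
      · intro p hp
        simp only [shapeOf, hp, if_true]
        split_ifs <;> exact cntS_le
      · intro p hp
        simp [shapeOf, hp]
  have hinj : Set.InjOn (fun l => shapeOf m n (up l)) ((insert 0 F : Finset ℚ) : Set ℚ) := by
    have key : ∀ l ∈ insert 0 F, ∀ l' ∈ insert 0 F,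
        shapeOf m n (up l) = shapeOf m n (up l') → ¬ l < l' := by
      intro l hl l' hl' he hlt
      have hl'F : l' ∈ F := by
        rcases mem_insert.1 hl' with h | h
        · have := G0 l hl
          linarith
        · exact h
      obtain ⟨i, j, h1, h2, h3, h4, hij⟩ := Fmem l' hl'F
      have e1 := (solup l hl).2.iff i j h1 h2 h3 h4
      have e2 := (solup l' hl').2.iff i j h1 h2 h3 h4
      rw [upiff _ i j h1 h2 h3 h4, ← hij, ← shapeOf_a h2, ← shapeOf_b h4] at e1 e2
      rw [he, e2] at e1
      have := e1.1 le_rfl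
      linarith
    intro l hl l' hl' he
    rcases lt_trichotomy l l' with h | h | h
    · exact absurd h (key l hl l' hl' he)
    · exact h
    · exact absurd h (key l' hl' l hl he.symm)
  rw [hset]
  refine ⟨(Finset.finite_toSet _).image _, ?_⟩
  rw [hinj.ncard_image, Set.ncard_coe_finset, card_insert_of_notMem, add_comm]
  intro h
  exact lt_irrefl _ (Fpos 0 h)
end

section
/- Let m and n be positive integers and let s, t ∈ [mn]. Then (s,t) ∈ T^{1,in}_{m,n} (i.e. (s,t) is the terminal pair of some injective L-shape of difference equation type of size (m,n)) if and only if there exists a real number ξ > 0 such that τ^{m,n}_ξ is injective on [m]×[n], τ^{m,n}_ξ(m,1) = s, and τ^{m,n}_ξ(1,n) = t. (In the paper's notation: TY_{m,n} = T^{1,in}_{m,n}, the vertex-set equality underlying Theorem 1.) -/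
open Finset
open scoped Classical

/-- The ranking table `τ^{m,n}_ξ(i,j) = #{(s,t) ∈ [m]×[n] : s + tξ ≤ i + jξ}`. -/
noncomputable def tau (m n : ℕ) (ξ : ℝ) (i j : ℕ) : ℕ :=
  ((Finset.Icc 1 m ×ˢ Finset.Icc 1 n).filter
    (fun p => (p.1 : ℝ) + (p.2 : ℝ) * ξ ≤ (i : ℝ) + (j : ℝ) * ξ)).card

/-- `Δ_{m,n}(ξ) = τ^{m,n}_ξ(m,1) − τ^{m,n}_ξ(1,n)` as an integer. -/
noncomputable def Delta (m n : ℕ) (ξ : ℝ) : ℤ :=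
  (tau m n ξ m 1 : ℤ) - (tau m n ξ 1 n : ℤ)

/-- The two arms of an L-shape as a pair of sequences. -/
def Good (m n : ℕ) (a b : ℕ → ℕ) : Prop :=
  a 1 = 1 ∧ b 1 = 1 ∧
  (∀ i, 1 ≤ i → i < m → a (i + 1) = a i + ((Finset.Icc 1 n).filter (fun t => b t ≤ a (i + 1))).card) ∧
  (∀ j, 1 ≤ j → j < n → b (j + 1) = b j + ((Finset.Icc 1 m).filter (fun s => a s ≤ b (j + 1))).card) ∧
  (∀ i j, 1 ≤ i → i ≤ m → 1 ≤ j → j ≤ n → a i = b j → i = 1 ∧ j = 1)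

/-- The real number `ξ` orders the arms in the same way. -/
def Compat (m n : ℕ) (a b : ℕ → ℕ) (ξ : ℝ) : Prop :=
  0 < ξ ∧ ∀ p q : ℕ, 1 ≤ p → p ≤ m → 1 ≤ q → q ≤ n →
    (a p < b q → (p : ℝ) - 1 < ((q : ℝ) - 1) * ξ) ∧ (b q < a p → ((q : ℝ) - 1) * ξ < (p : ℝ) - 1)

lemma Good.swap {m n : ℕ} {a b : ℕ → ℕ} (h : Good m n a b) : Good n m b a := by
  obtain ⟨h1, h2, h3, h4, h5⟩ := h
  exact ⟨h2, h1, h4, h3, fun i j a1 a2 a3 a4 e => (h5 j i a3 a4 a1 a2 e.symm).symm⟩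

lemma Compat.swap {m n : ℕ} {a b : ℕ → ℕ} {ξ : ℝ} (h : Compat m n a b ξ) :
    Compat n m b a ξ⁻¹ := by
  obtain ⟨h0, h⟩ := h
  refine ⟨inv_pos.2 h0, fun p q a1 a2 a3 a4 => ?_⟩
  obtain ⟨u, v⟩ := h q p a3 a4 a1 a2
  constructor
  · intro e
    rw [← div_eq_mul_inv, lt_div_iff₀ h0]
    exact v e
  · intro e
    rw [← div_eq_mul_inv, div_lt_iff₀ h0]
    exact u e

lemma tau_swap (m n : ℕ) (ξ : ℝ) (h0 : 0 < ξ) (i j : ℕ) :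
    tau m n ξ i j = tau n m ξ⁻¹ j i := by
  unfold tau
  refine Finset.card_bij (fun p _ => (p.2, p.1)) ?_ ?_ ?_
  · rintro ⟨x, y⟩ h
    simp only [Finset.mem_filter, Finset.mem_product] at h ⊢
    refine ⟨⟨h.1.2, h.1.1⟩, ?_⟩
    have := mul_le_mul_of_nonneg_right h.2 (inv_pos.2 h0).le
    simp only [add_mul, mul_assoc, mul_inv_cancel₀ h0.ne', mul_one] at this
    linarith
  · rintro ⟨x, y⟩ _ ⟨x', y'⟩ _ h
    simp only [Prod.mk.injEq] at h ⊢
    exact h.symm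
  · rintro ⟨x, y⟩ h
    simp only [Finset.mem_filter, Finset.mem_product] at h
    refine ⟨(y, x), ?_, rfl⟩
    simp only [Finset.mem_filter, Finset.mem_product]
    refine ⟨⟨h.1.2, h.1.1⟩, ?_⟩
    have := mul_le_mul_of_nonneg_right h.2 h0.le
    simp only [add_mul, mul_assoc, inv_mul_cancel₀ h0.ne', mul_one] at this
    linarith

lemma tau_succ (m n : ℕ) (ξ : ℝ) (h0 : 0 < ξ) (i : ℕ) (hi : 1 ≤ i) (him : i < m) :
    tau m n ξ (i + 1) 1 = tau m n ξ i 1 +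
      ((Finset.Icc 1 n).filter (fun t : ℕ => (1 : ℝ) + (t : ℝ) * ξ ≤ (i : ℝ) + 1 + ξ)).card := by
  unfold tau
  rw [← Finset.card_image_of_injective (f := fun p : ℕ × ℕ => (p.1 + 1, p.2))
      (Finset.filter (fun p => (p.1 : ℝ) + (p.2 : ℝ) * ξ ≤ (i : ℝ) + ((1 : ℕ) : ℝ) * ξ)
        (Finset.Icc 1 m ×ˢ Finset.Icc 1 n))
      (by rintro ⟨x, y⟩ ⟨x', y'⟩ h; simpa using h),
    ← Finset.card_image_of_injective (f := fun t : ℕ => ((1 : ℕ), t))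
      (Finset.filter _ (Finset.Icc 1 n)) (by intro x y h; simpa using h),
    ← Finset.card_union_of_disjoint]
  · congr 1
    ext ⟨x, y⟩
    simp only [Finset.mem_filter, Finset.mem_product, Finset.mem_union, Finset.mem_image,
      Finset.mem_Icc, Prod.exists, Prod.mk.injEq]
    constructor
    · rintro ⟨⟨⟨x1, x2⟩, y1, y2⟩, h⟩
      push_cast at h
      by_cases hx : x = 1
      · right
        subst hx
        refine ⟨y, ⟨⟨y1, y2⟩, ?_⟩, rfl, rfl⟩
        push_cast at h
        linarith
      · left
        obtain ⟨z, rfl⟩ : ∃ z, x = z + 1 := ⟨x - 1, by omega⟩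
        refine ⟨z, y, ⟨⟨⟨by omega, by omega⟩, y1, y2⟩, ?_⟩, rfl, rfl⟩
        push_cast at h ⊢
        linarith
    · rintro (⟨z, w, ⟨⟨⟨x1, x2⟩, y1, y2⟩, h⟩, rfl, rfl⟩ | ⟨w, ⟨⟨y1, y2⟩, h⟩, rfl, rfl⟩)
      · have : z ≤ i := by
          have hw : (1 : ℝ) ≤ w := by exact_mod_cast y1
          have : (z : ℝ) ≤ i := by push_cast at h; nlinarith
          exact_mod_cast this
        refine ⟨⟨⟨by omega, by omega⟩, y1, y2⟩, ?_⟩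
        push_cast at h ⊢
        linarith
      · refine ⟨⟨⟨by omega, by omega⟩, y1, y2⟩, ?_⟩
        push_cast at h ⊢
        linarith
  · rw [Finset.disjoint_left]
    rintro ⟨x, y⟩ h h'
    simp only [Finset.mem_filter, Finset.mem_product, Finset.mem_image,
      Finset.mem_Icc, Prod.exists, Prod.mk.injEq] at h h'
    obtain ⟨z, w, h, rfl, rfl⟩ := h
    obtain ⟨v, _, e, _⟩ := h'
    omega

lemma tau_one (m n : ℕ) (hm : 1 ≤ m) (hn : 1 ≤ n) (ξ : ℝ) (h0 : 0 < ξ) : tau m n ξ 1 1 = 1 := by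
  unfold tau
  rw [Finset.card_eq_one]
  refine ⟨(1, 1), ?_⟩
  ext ⟨x, y⟩
  simp only [Finset.mem_filter, Finset.mem_product, Finset.mem_Icc, Finset.mem_singleton,
    Prod.mk.injEq]
  constructor
  · rintro ⟨⟨⟨x1, x2⟩, y1, y2⟩, h⟩
    have hx : (1 : ℝ) ≤ x := by exact_mod_cast x1
    have hy : (1 : ℝ) ≤ y := by exact_mod_cast y1
    push_cast at h
    have e1 : (x : ℝ) ≤ 1 := by nlinarith
    have e2 : (y : ℝ) ≤ 1 := by nlinarith
    have e1 : x ≤ 1 := by exact_mod_cast e1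
    have e2 : y ≤ 1 := by exact_mod_cast e2
    omega
  · rintro ⟨rfl, rfl⟩
    exact ⟨⟨⟨le_refl _, hm⟩, le_refl _, hn⟩, le_refl _⟩

lemma tau_mono (m n : ℕ) (ξ : ℝ) (i j k l : ℕ)
    (h : (i : ℝ) + (j : ℝ) * ξ ≤ (k : ℝ) + (l : ℝ) * ξ) : tau m n ξ i j ≤ tau m n ξ k l := by
  unfold tau
  apply Finset.card_le_card
  intro p hp
  simp only [Finset.mem_filter] at hp ⊢
  exact ⟨hp.1, hp.2.trans h⟩

lemma tau_strict (m n : ℕ) (ξ : ℝ) (i j k l : ℕ) (k1 : 1 ≤ k) (k2 : k ≤ m) (l1 : 1 ≤ l)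
    (l2 : l ≤ n)
    (h : (i : ℝ) + (j : ℝ) * ξ < (k : ℝ) + (l : ℝ) * ξ) : tau m n ξ i j < tau m n ξ k l := by
  unfold tau
  apply Finset.card_lt_card
  rw [Finset.ssubset_iff_of_subset]
  · refine ⟨(k, l), ?_, ?_⟩
    · simp only [Finset.mem_filter, Finset.mem_product, Finset.mem_Icc]
      exact ⟨⟨⟨k1, k2⟩, l1, l2⟩, le_refl _⟩
    · simp only [Finset.mem_filter, not_and, not_le]
      exact fun _ => h
  · intro p hp
    simp only [Finset.mem_filter] at hp ⊢
    exact ⟨hp.1, hp.2.trans h.le⟩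

lemma uniq_a {m n : ℕ} {a b : ℕ → ℕ} {ξ : ℝ} (hm : 1 ≤ m) (hn : 1 ≤ n)
    (g : Good m n a b) (c : Compat m n a b ξ) (i : ℕ) (hi : 1 ≤ i) (him : i ≤ m) :
    a i = tau m n ξ i 1 := by
  obtain ⟨h1, h2, h3, h4, h5⟩ := g
  induction i, hi using Nat.le_induction with
  | base => rw [h1, tau_one m n hm hn ξ c.1]
  | succ i hi ih =>
    rw [h3 i hi (by omega), tau_succ m n ξ c.1 i hi (by omega), ih (by omega)]
    congr 2
    apply Finset.filter_congr
    intro t ht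
    rw [Finset.mem_Icc] at ht
    have hne : a (i + 1) ≠ b t := fun e => by
      have := h5 _ _ (by omega) him ht.1 ht.2 e
      omega
    obtain ⟨u, v⟩ := c.2 (i + 1) t (by omega) him ht.1 ht.2
    push_cast at u v
    constructor
    · intro e
      have := v (by omega)
      linarith
    · intro e
      by_contra hc
      have := u (by omega)
      linarith

lemma uniq_b {m n : ℕ} {a b : ℕ → ℕ} {ξ : ℝ} (hm : 1 ≤ m) (hn : 1 ≤ n)
    (g : Good m n a b) (c : Compat m n a b ξ) (j : ℕ) (hj : 1 ≤ j) (hjn : j ≤ n) :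
    b j = tau m n ξ 1 j := by
  rw [tau_swap m n ξ c.1]
  exact uniq_a hn hm g.swap c.swap j hj hjn

lemma key (m n : ℕ) (ξ : ℝ) (h0 : 0 < ξ) (p q : ℕ) (hp : p < m) (hq : q < n)
    (h1 : (p : ℝ) < q * ξ) (h2 : m * q ≤ p * (n - 1)) :
    tau m n ξ m 1 + n ≤ tau m n ξ 1 n := by
  obtain ⟨n, rfl⟩ : ∃ k, n = k + 1 := ⟨n - 1, by omega⟩
  rw [Nat.add_sub_cancel] at h2
  have q0 : 0 < q := by
    rcases Nat.eq_zero_or_pos q with rfl | h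
    · simp only [Nat.cast_zero, zero_mul] at h1
      have : (0 : ℝ) ≤ p := Nat.cast_nonneg p
      linarith
    · exact h
  have p0 : 0 < p := by
    rcases Nat.eq_zero_or_pos p with rfl | h
    · have := Nat.mul_pos hp q0
      omega
    · exact h
  have qn : q < n := by
    by_contra hc
    have e1 : p * n ≤ p * q := Nat.mul_le_mul_left _ (by omega)
    have e2 : p * q < m * q := Nat.mul_lt_mul_of_pos_right hp q0
    omega
  have q0' : (0 : ℝ) < q := by exact_mod_cast q0
  have p0' : (0 : ℝ) < p := by exact_mod_cast p0
  have qn' : (q : ℝ) < n := by exact_mod_cast qn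
  have hp' : (p : ℝ) + 1 ≤ m := by exact_mod_cast hp
  have h2' : (m : ℝ) * q ≤ p * n := by exact_mod_cast h2
  have E1 : (m : ℝ) - p < (n - q) * ξ := by
    have : ((m : ℝ) - p) * q < ((n - q) * ξ) * q := by nlinarith
    exact lt_of_mul_lt_mul_right this q0'.le
  have E2 : (m : ℝ) < n * ξ := by linarith
  -- the chosen row entry
  let g : ℕ → ℕ × ℕ := fun t => (⌊(m : ℝ) - ((t : ℝ) - 1) * ξ⌋₊ + 1, t)
  have ginj : Function.Injective g := fun x y h => (Prod.mk.inj h).2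
  let e : ℕ × ℕ := (p + 1, n + 1 - q)
  have hcast : ((n + 1 - q : ℕ) : ℝ) = n + 1 - q := by
    rw [Nat.cast_sub (by omega)]; push_cast; ring
  have en : e ∉ (Finset.Icc 2 (n + 1)).image g := by
    simp only [Finset.mem_image, not_exists, not_and]
    intro t _ h
    obtain ⟨u, v⟩ := Prod.mk.inj h
    subst v
    have : ⌊(m : ℝ) - (((n + 1 - q : ℕ) : ℝ) - 1) * ξ⌋₊ < p := by
      rw [Nat.floor_lt' (by omega), hcast]
      nlinarith
    omega
  have hcard : (insert e ((Finset.Icc 2 (n + 1)).image g)).card = n + 1 := by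
    rw [Finset.card_insert_of_notMem en, Finset.card_image_of_injective _ ginj]
    simp
  unfold tau
  refine (Nat.add_le_add_left hcard.ge _).trans ?_
  rw [← Finset.card_union_of_disjoint]
  · apply Finset.card_le_card
    intro x hx
    simp only [Finset.mem_union, Finset.mem_insert, Finset.mem_image] at hx
    rcases hx with hx | rfl | ⟨t, ht, rfl⟩
    · simp only [Finset.mem_filter] at hx ⊢
      refine ⟨hx.1, hx.2.trans ?_⟩
      push_cast
      nlinarith
    · simp only [Finset.mem_filter, Finset.mem_product, Finset.mem_Icc, e]
      refine ⟨⟨⟨by omega, by omega⟩, by omega, by omega⟩, ?_⟩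
      rw [hcast]
      push_cast
      nlinarith
    · rw [Finset.mem_Icc] at ht
      have t1 : (2 : ℝ) ≤ t := by exact_mod_cast ht.1
      have t2 : (t : ℝ) ≤ n + 1 := by exact_mod_cast ht.2
      simp only [Finset.mem_filter, Finset.mem_product, Finset.mem_Icc, g]
      refine ⟨⟨⟨by omega, ?_⟩, by omega, by omega⟩, ?_⟩
      · have : ⌊(m : ℝ) - ((t : ℝ) - 1) * ξ⌋₊ < m := by
          rw [Nat.floor_lt' (by omega)]
          nlinarith
        omega
      · push_cast
        rcases le_total 0 ((m : ℝ) - ((t : ℝ) - 1) * ξ) with hc | hc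
        · have := Nat.floor_le hc
          nlinarith
        · rw [Nat.floor_of_nonpos hc]
          push_cast
          nlinarith
  · rw [Finset.disjoint_left]
    intro x hx hx'
    simp only [Finset.mem_filter] at hx
    have hx := hx.2
    simp only [Finset.mem_insert, Finset.mem_image] at hx'
    rcases hx' with rfl | ⟨t, ht, rfl⟩
    · simp only [e, hcast] at hx
      push_cast at hx
      nlinarith
    · simp only [g] at hx
      push_cast at hx
      have := Nat.lt_floor_add_one ((m : ℝ) - ((t : ℝ) - 1) * ξ)
      nlinarith

lemma Good.mono_b {m n : ℕ} {a b : ℕ → ℕ} (g : Good m n a b) (j k : ℕ) (hj : 1 ≤ j)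
    (hjk : j ≤ k) (hk : k ≤ n) : b j ≤ b k := by
  induction k, hjk using Nat.le_induction with
  | base => exact le_refl _
  | succ k hk' ih =>
    have := g.2.2.2.1 k (by omega) (by omega)
    have := ih (by omega)
    omega

lemma Good.restrict {m n : ℕ} {a b : ℕ → ℕ} (g : Good (m + 1) n a b)
    (hlt : b n < a (m + 1)) : Good m n a b := by
  have mb := g.mono_b
  obtain ⟨h1, h2, h3, h4, h5⟩ := g
  refine ⟨h1, h2, fun i hi him => h3 i hi (by omega), fun j hj hjn => ?_,
    fun i j a1 a2 a3 a4 => h5 i j a1 (by omega) a3 a4⟩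
  rw [h4 j hj hjn]
  congr 2
  ext s
  simp only [Finset.mem_filter, Finset.mem_Icc]
  have hb := mb (j + 1) n (by omega) (by omega) (le_refl _)
  have hq := h4 j hj hjn
  rw [← hq]
  constructor
  · rintro ⟨⟨s1, s2⟩, h⟩
    refine ⟨⟨s1, ?_⟩, h⟩
    by_contra hc
    have : s = m + 1 := by omega
    subst this
    omega
  · rintro ⟨⟨s1, s2⟩, h⟩
    exact ⟨⟨s1, by omega⟩, h⟩

lemma stepA {m n : ℕ} {a b : ℕ → ℕ} {ξ : ℝ} (hm : 1 ≤ m) (hn : 1 ≤ n)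
    (g : Good (m + 1) n a b) (hlt : b n < a (m + 1)) (c : Compat m n a b ξ) :
    ∃ ξ' : ℝ, Compat (m + 1) n a b ξ' := by
  have g' := g.restrict hlt
  have ha := uniq_a hm hn g' c m hm (le_refl _)
  have hb := uniq_b hm hn g' c n hn (le_refl _)
  have hstep : a (m + 1) = a m + n := by
    rw [g.2.2.1 m hm (by omega)]
    congr 1
    rw [Finset.filter_true_of_mem]
    · simp
    · intro t ht
      rw [Finset.mem_Icc] at ht
      have := g.mono_b t n ht.1 ht.2 (le_refl _)
      omega
  have nokey : ∀ p q : ℕ, 1 ≤ p → p ≤ m → 1 ≤ q → q ≤ n → a p < b q →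
      (p - 1) * (n - 1) < m * (q - 1) := by
    intro p q p1 p2 q1 q2 h
    by_contra hc
    have hx := (c.2 p q p1 p2 q1 q2).1 h
    have := key m n ξ c.1 (p - 1) (q - 1) (by omega) (by omega)
      (by rw [Nat.cast_sub p1, Nat.cast_sub q1]; simpa using hx) (by omega)
    omega
  -- enough: a compatible value not exceeding `ξ`
  have fin : ∀ x : ℝ, 0 < x → x ≤ ξ → ((n : ℝ) - 1) * x < m →
      (∀ p q : ℕ, 1 ≤ p → p ≤ m → 1 ≤ q → q ≤ n → a p < b q →
        (p : ℝ) - 1 < ((q : ℝ) - 1) * x) → ∃ ξ' : ℝ, Compat (m + 1) n a b ξ' := by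
    intro x x0 xξ hx hlow
    refine ⟨x, x0, fun p q p1 p2 q1 q2 => ?_⟩
    have q1' : (1 : ℝ) ≤ q := by exact_mod_cast q1
    have q2' : (q : ℝ) ≤ n := by exact_mod_cast q2
    have hbq := g.mono_b q n q1 q2 (le_refl _)
    rcases Nat.lt_or_ge m p with hp | hp
    · have : p = m + 1 := by omega
      subst this
      refine ⟨fun h => by omega, fun _ => ?_⟩
      push_cast
      nlinarith
    · refine ⟨hlow p q p1 hp q1 q2, fun h => ?_⟩
      have := (c.2 p q p1 hp q1 q2).2 h
      nlinarith
  by_cases hc : ((n : ℝ) - 1) * ξ < m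
  · exact fin ξ c.1 (le_refl _) hc fun p q p1 p2 q1 q2 h => (c.2 p q p1 p2 q1 q2).1 h
  · have m0 : (0 : ℝ) < m := by exact_mod_cast hm
    have n0 : (0 : ℝ) < (n : ℝ) - 1 := by
      by_contra hneg
      have := c.1
      nlinarith
    have key2 : ∀ᶠ x in nhds ((m : ℝ) / ((n : ℝ) - 1)),
        ∀ r ∈ Finset.Icc 1 m ×ˢ Finset.Icc 1 n, a r.1 < b r.2 →
          (r.1 : ℝ) - 1 < ((r.2 : ℝ) - 1) * x := by
      rw [Filter.eventually_all_finset]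
      rintro ⟨p, q⟩ hr
      simp only [Finset.mem_product, Finset.mem_Icc] at hr
      obtain ⟨⟨p1, p2⟩, q1, q2⟩ := hr
      by_cases h : a p < b q
      · have hk := nokey p q p1 p2 q1 q2 h
        have hk' : ((p : ℝ) - 1) * ((n : ℝ) - 1) < m * ((q : ℝ) - 1) := by
          have : (((p - 1) * (n - 1) : ℕ) : ℝ) < ((m * (q - 1) : ℕ) : ℝ) := by exact_mod_cast hk
          push_cast [Nat.cast_sub p1, Nat.cast_sub q1, Nat.cast_sub hn] at this
          exact this
        have hu : (p : ℝ) - 1 < ((q : ℝ) - 1) * ((m : ℝ) / ((n : ℝ) - 1)) := by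
          rw [← mul_div_assoc, lt_div_iff₀ n0]
          linarith
        have hcont : Continuous fun x : ℝ => ((q : ℝ) - 1) * x := by fun_prop
        filter_upwards [hcont.continuousAt.eventually (lt_mem_nhds hu)] with x hx _
        exact hx
      · exact Filter.Eventually.of_forall fun x h' => absurd h' h
    have key3 := key2.and (lt_mem_nhds (div_pos m0 n0))
    have key4 : ∀ᶠ x in nhdsWithin ((m : ℝ) / ((n : ℝ) - 1)) (Set.Iio ((m : ℝ) / ((n : ℝ) - 1))),
        (_ ∧ _) ∧ x ∈ Set.Iio ((m : ℝ) / ((n : ℝ) - 1)) :=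
      (key3.filter_mono nhdsWithin_le_nhds).and self_mem_nhdsWithin
    obtain ⟨x, ⟨hx1, hx2⟩, hx3⟩ := key4.exists
    have hx4 : x * ((n : ℝ) - 1) < m := (lt_div_iff₀ n0).1 hx3
    refine fin x hx2 ?_ (by linarith) fun p q p1 p2 q1 q2 h => hx1 (p, q) ?_ h
    · by_contra hneg
      nlinarith
    · simp only [Finset.mem_product, Finset.mem_Icc]
      exact ⟨⟨p1, p2⟩, q1, q2⟩

lemma exists_compat (N : ℕ) : ∀ (m n : ℕ) (a b : ℕ → ℕ), m + n = N → 1 ≤ m → 1 ≤ n →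
    Good m n a b → ∃ ξ : ℝ, Compat m n a b ξ := by
  induction N with
  | zero => intro m n a b h h1; omega
  | succ N ih =>
    have half : ∀ (m n : ℕ) (a b : ℕ → ℕ), m + n = N + 1 → 1 ≤ m → 1 ≤ n →
        Good m n a b → b n < a m → ∃ ξ : ℝ, Compat m n a b ξ := by
      intro m n a b hN hm hn g hlt
      by_cases hm1 : m = 1
      · subst hm1
        have := g.mono_b 1 n (le_refl _) hn (le_refl _)
        have := g.1
        have := g.2.1
        omega
      · obtain ⟨k, rfl⟩ : ∃ k, m = k + 1 := ⟨m - 1, by omega⟩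
        obtain ⟨ξ, c⟩ := ih k n a b (by omega) (by omega) hn (g.restrict hlt)
        exact stepA (by omega) hn g hlt c
    intro m n a b hN hm hn g
    rcases lt_trichotomy (a m) (b n) with h | h | h
    · obtain ⟨ξ, c⟩ := half n m b a (by omega) hn hm g.swap h
      exact ⟨_, c.swap⟩
    · obtain ⟨rfl, rfl⟩ := g.2.2.2.2 m n hm (le_refl _) hn (le_refl _) h
      refine ⟨1, one_pos, fun p q p1 p2 q1 q2 => ?_⟩
      have : p = 1 := by omega
      have : q = 1 := by omega
      subst p q
      constructor <;> intro <;> omega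
    · exact half m n a b hN hm hn g h

lemma good_of_DE {m n : ℕ} {f : ℕ × ℕ → ℕ} (h : isLShapeDE m n f) :
    Good m n (fun i => f (i, 1)) (fun j => f (1, j)) := by
  obtain ⟨inj, -, h1, h2, h3⟩ := h
  refine ⟨h1, h1, fun i hi him => ?_, fun j hj hjn => ?_, fun i j a1 a2 a3 a4 e => ?_⟩
  · have := h2 i (Finset.mem_Icc.2 ⟨hi, by omega⟩)
    simp only
    omega
  · have := h3 j (Finset.mem_Icc.2 ⟨hj, by omega⟩)
    simp only
    omega
  · have := inj (x₁ := (i, 1)) (x₂ := (1, j))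
      (by simp [LShape]; omega) (by simp [LShape]; omega) e
    simp only [Prod.mk.injEq] at this
    omega

lemma injOn_of_ne (m n : ℕ) (ξ : ℝ)
    (h : ∀ p q p' q' : ℕ, 1 ≤ p → p ≤ m → 1 ≤ q → q ≤ n → 1 ≤ p' → p' ≤ m → 1 ≤ q' → q' ≤ n →
      (p : ℝ) + q * ξ = p' + q' * ξ → p = p' ∧ q = q') :
    Set.InjOn (fun p : ℕ × ℕ => tau m n ξ p.1 p.2)
      ↑(Finset.Icc 1 m ×ˢ Finset.Icc 1 n) := by
  rintro ⟨p, q⟩ hp ⟨p', q'⟩ hp' e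
  simp only [Finset.mem_coe, Finset.mem_product, Finset.mem_Icc] at hp hp' e
  obtain ⟨⟨p1, p2⟩, q1, q2⟩ := hp
  obtain ⟨⟨p1', p2'⟩, q1', q2'⟩ := hp'
  rcases lt_trichotomy ((p : ℝ) + q * ξ) (p' + q' * ξ) with hl | hl | hl
  · have := tau_strict m n ξ p q p' q' p1' p2' q1' q2' hl
    omega
  · obtain ⟨rfl, rfl⟩ := h p q p' q' p1 p2 q1 q2 p1' p2' q1' q2' hl
    rfl
  · have := tau_strict m n ξ p' q' p q p1 p2 q1 q2 hl
    omega

lemma compat_ne {m n : ℕ} {a b : ℕ → ℕ} {ξ : ℝ}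
    (g : Good m n a b) (c : Compat m n a b ξ) (p q p' q' : ℕ) (p1 : 1 ≤ p) (p2 : p ≤ m)
    (q1' : 1 ≤ q') (q2' : q' ≤ n) (q1 : 1 ≤ q) (p1' : 1 ≤ p') (hpp : p' ≤ p)
    (e : (p : ℝ) + q * ξ = p' + q' * ξ) : p = p' ∧ q = q' := by
  have hqq : q ≤ q' := by
    by_contra hc
    have h1 : (q' : ℝ) < q := by exact_mod_cast (not_le.1 hc)
    have h2 : (p' : ℝ) ≤ p := by exact_mod_cast hpp
    have := c.1
    nlinarith
  obtain ⟨x, rfl⟩ := Nat.exists_eq_add_of_le hpp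
  obtain ⟨y, rfl⟩ := Nat.exists_eq_add_of_le hqq
  push_cast at e
  have exy : (x : ℝ) = y * ξ := by linarith
  obtain ⟨u, v⟩ := c.2 (x + 1) (y + 1) (by omega) (by omega) (by omega) (by omega)
  push_cast at u v
  rcases lt_trichotomy (a (x + 1)) (b (y + 1)) with h | h | h
  · have := u h
    linarith
  · have := g.2.2.2.2 (x + 1) (y + 1) (by omega) (by omega) (by omega) (by omega) h
    omega
  · have := v h
    linarith

lemma tau_condA (m n : ℕ) (ξ : ℝ) (h0 : 0 < ξ) (i : ℕ) (hi : 1 ≤ i) (him : i < m) :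
    tau m n ξ (i + 1) 1 = tau m n ξ i 1 +
      ((Finset.Icc 1 n).filter (fun t : ℕ => tau m n ξ 1 t ≤ tau m n ξ (i + 1) 1)).card := by
  rw [tau_succ m n ξ h0 i hi him]
  congr 2
  apply Finset.filter_congr
  intro t ht
  rw [Finset.mem_Icc] at ht
  rw [← tau_succ m n ξ h0 i hi him]
  constructor
  · intro h
    apply tau_mono
    push_cast
    linarith
  · intro h
    by_contra hc
    have := tau_strict m n ξ (i + 1) 1 1 t (le_refl _) (by omega) ht.1 ht.2
      (by push_cast; linarith)
    omega

/-- `TY_{m,n} = T^{1,in}_{m,n}`: `(s,t)` is the terminal pair of an injective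
L-shape of difference equation type iff it is the terminal pair of an injective ranking table. -/
theorem terminalPair_iff_young (m n : ℕ) (hm : 1 ≤ m) (hn : 1 ≤ n)
    (s t : ℕ) (hs : s ∈ Finset.Icc 1 (m * n)) (ht : t ∈ Finset.Icc 1 (m * n)) :
    (∃ f : ℕ × ℕ → ℕ, isLShapeDE m n f ∧ f (m, 1) = s ∧ f (1, n) = t) ↔
      ∃ ξ : ℝ, 0 < ξ ∧
        Set.InjOn (fun p : ℕ × ℕ => tau m n ξ p.1 p.2)
          ↑(Finset.Icc 1 m ×ˢ Finset.Icc 1 n) ∧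
        tau m n ξ m 1 = s ∧ tau m n ξ 1 n = t := by
  constructor
  · rintro ⟨f, hf, rfl, rfl⟩
    have g := good_of_DE hf
    obtain ⟨ξ, c⟩ := exists_compat _ m n _ _ rfl hm hn g
    refine ⟨ξ, c.1, injOn_of_ne m n ξ ?_, (uniq_a hm hn g c m hm (le_refl _)).symm,
      (uniq_b hm hn g c n hn (le_refl _)).symm⟩
    intro p q p' q' p1 p2 q1 q2 p1' p2' q1' q2' e
    rcases le_total p' p with h | h
    · exact compat_ne g c p q p' q' p1 p2 q1' q2' q1 p1' h e
    · have := compat_ne g c p' q' p q p1' p2' q1 q2 q1' p1 h e.symm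
      exact ⟨this.1.symm, this.2.symm⟩
  · rintro ⟨ξ, h0, inj, rfl, rfl⟩
    have sub : ∀ p ∈ LShape m n, p ∈ Finset.Icc 1 m ×ˢ Finset.Icc 1 n := by
      rintro ⟨x, y⟩ hp
      simp only [LShape, Finset.mem_union, Finset.mem_product, Finset.mem_Icc,
        Finset.mem_singleton] at hp ⊢
      omega
    refine ⟨fun p => tau m n ξ p.1 p.2, ⟨inj.mono sub, ?_, tau_one m n hm hn ξ h0, ?_, ?_⟩,
      rfl, rfl⟩
    · intro p hp
      have hp := sub p hp
      rw [Finset.mem_Icc]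
      constructor
      · apply Finset.card_pos.2
        exact ⟨p, Finset.mem_filter.2 ⟨hp, le_refl _⟩⟩
      · refine (Finset.card_filter_le _ _).trans ?_
        simp
    · intro i hi
      rw [Finset.mem_Icc] at hi
      have := tau_condA m n ξ h0 i hi.1 (by omega)
      simp only
      omega
    · intro j hj
      rw [Finset.mem_Icc] at hj
      have := tau_condA n m ξ⁻¹ (inv_pos.2 h0) j hj.1 (by omega)
      simp only [← tau_swap m n ξ h0] at this
      simp only
      omega
end
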